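/- For every signed graph (G,σ) and positive integer k, the chromatic number of the exact-distance -k graph of (G,σ) is at most dcol_{2k}(G); moreover, if k is odd then it is at most dcol_{2k-1}(G). -/

import Mathlib

open SimpleGraph

/-- The number of negative edges of a walk, where `σ e = true` means edge `e` is negative. -/
def negCount {V : Type} {G : SimpleGraph V} (σ : Sym2 V → Bool) {x y : V}
    (p : G.Walk x y) : ℕ :=
  (p.edges.filter (fun e => σ e)).length

/-- A walk is negative if it contains an odd number of negative edges. -/
def IsNegWalk {V : Type} {G : SimpleGraph V} (σ : Sym2 V → Bool) {x y : V}
    (p : G.Walk x y) : Prop :=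
  Odd (negCount σ p)

/-- The exact-distance `-k` graph of the signed graph `(G, σ)`:
`xy` is an edge iff `d_G(x,y) = k` and every `xy`-path of length `k` is negative. -/
def exactDistNeg {V : Type} (G : SimpleGraph V) (σ : Sym2 V → Bool) (k : ℕ) :
    SimpleGraph V :=
  SimpleGraph.fromRel (fun x y =>
    G.dist x y = k ∧ ∀ p : G.Walk x y, p.IsPath → p.length = k → IsNegWalk σ p)

/-- The strong exact-distance `-k` graph of the signed graph `(G, σ)`:
`xy` is an edge iff `d_G(x,y) = k` and some `xy`-path of length `k` is negative. -/
def strongExactDistNeg {V : Type} (G : SimpleGraph V) (σ : Sym2 V → Bool) (k : ℕ) :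
    SimpleGraph V :=
  SimpleGraph.fromRel (fun x y =>
    G.dist x y = k ∧ ∃ p : G.Walk x y, p.IsPath ∧ p.length = k ∧ IsNegWalk σ p)

/-- `WReach G L k y` : the set of vertices weakly `k`-reachable from `y` w.r.t. ordering `L`. -/
def WReach {V : Type} (G : SimpleGraph V) (L : LinearOrder V) (k : ℕ) (y : V) : Set V :=
  {x | ∃ p : G.Walk x y, p.IsPath ∧ p.length ≤ k ∧ ∀ z ∈ p.support, L.le x z}

/-- The weak `k`-colouring number of `G`. -/
noncomputable def wcol {V : Type} (G : SimpleGraph V) (k : ℕ) : ℕ :=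
  ⨅ L : LinearOrder V, ⨆ y : V, (WReach G L k y).ncard

/-- `DReach G L k y` : the set of vertices `x` such that there is an `xy`-path
`z_0, …, z_s` (`x = z_0`, `y = z_s`) of length `s ≤ k` on which `x` is the `L`-minimum
and `y ≤_L z_i` for all `⌊k/2⌋ + 1 ≤ i ≤ s`. -/
def DReach {V : Type} (G : SimpleGraph V) (L : LinearOrder V) (k : ℕ) (y : V) : Set V :=
  {x | ∃ p : G.Walk x y, p.IsPath ∧ p.length ≤ k ∧ (∀ z ∈ p.support, L.le x z) ∧
        ∀ i, k / 2 + 1 ≤ i → i ≤ p.length → L.le y (p.support.getD i y)}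

/-- The distance-`k`-colouring number of `G`. -/
noncomputable def dcol {V : Type} (G : SimpleGraph V) (k : ℕ) : ℕ :=
  ⨅ L : LinearOrder V, ⨆ y : V, (DReach G L k y).ncard

/-- `SReach G L k y` : the set of vertices strongly `k`-reachable from `y` w.r.t. `L`. -/
def SReach {V : Type} (G : SimpleGraph V) (L : LinearOrder V) (k : ℕ) (y : V) : Set V :=
  {x | ∃ p : G.Walk x y, p.IsPath ∧ p.length ≤ k ∧ (∀ z ∈ p.support, L.le x z) ∧
        ∀ z ∈ p.support, z ≠ x → L.le y z}

/-- The strong `k`-colouring number of `G`. -/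
noncomputable def scol {V : Type} (G : SimpleGraph V) (k : ℕ) : ℕ :=
  ⨅ L : LinearOrder V, ⨆ y : V, (SReach G L k y).ncard

/-- `H` is a minor of `G` (branch-set definition). -/
def IsMinor {W V : Type} (H : SimpleGraph W) (G : SimpleGraph V) : Prop :=
  ∃ B : W → Set V,
    (∀ w, (B w).Nonempty) ∧
    (∀ w, (G.induce (B w)).Connected) ∧
    (Pairwise (Function.onFun Disjoint B)) ∧
    ∀ w w', H.Adj w w' → ∃ u ∈ B w, ∃ v ∈ B w', G.Adj u v

/-- `G` is planar iff it has no `K₅` and no `K₃,₃` minor (Wagner's theorem). -/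
def IsPlanar {V : Type} (G : SimpleGraph V) : Prop :=
  ¬ IsMinor (completeGraph (Fin 5)) G ∧
  ¬ IsMinor (completeBipartiteGraph (Fin 3) (Fin 3)) G

/-- `G` is outerplanar iff it has no `K₄` and no `K₂,₃` minor. -/
def IsOuterplanar {V : Type} (G : SimpleGraph V) : Prop :=
  ¬ IsMinor (completeGraph (Fin 4)) G ∧
  ¬ IsMinor (completeBipartiteGraph (Fin 2) (Fin 3)) G

/-- `G` has treewidth at most `t` (tree-decomposition definition). -/
def HasTreewidthLE {V : Type} (G : SimpleGraph V) (t : ℕ) : Prop :=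
  ∃ (ι : Type) (T : SimpleGraph ι) (B : ι → Finset V),
    T.Connected ∧ T.IsAcyclic ∧
    (∀ v, ∃ i, v ∈ B i) ∧
    (∀ u v, G.Adj u v → ∃ i, u ∈ B i ∧ v ∈ B i) ∧
    (∀ v, (T.induce {i | v ∈ B i}).Connected) ∧
    (∀ i, (B i).card ≤ t + 1)
section ExactDistance

variable {V : Type} {G : SimpleGraph V}

theorem negCount_append (σ : Sym2 V → Bool) {x y z : V} (p : G.Walk x y) (q : G.Walk y z) :
    negCount σ (p.append q) = negCount σ p + negCount σ q := by
  simp [negCount, Walk.edges_append]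

theorem negCount_reverse (σ : Sym2 V → Bool) {x y : V} (p : G.Walk x y) :
    negCount σ p.reverse = negCount σ p := by
  simp [negCount, Walk.edges_reverse]

/-- To be in `DReach`, it suffices to be the start of a suitable walk: shortcutting a walk to a
path only moves vertices towards the start. -/
theorem mem_DReach_of_walk {L : LinearOrder V} {n : ℕ} {a b : V} (p : G.Walk a b)
    (hlen : p.length ≤ n) (ha : ∀ i, L.le a (p.getVert i))
    (hb : ∀ i, n / 2 + 1 ≤ i → L.le b (p.getVert i)) : a ∈ DReach G L n b := by
  classical
  obtain ⟨f, hf⟩ :=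
    List.sublist_iff_exists_orderEmbedding_getElem?_eq.mp p.support_bypass_sublist_support
  refine ⟨p.bypass, p.bypass_isPath, p.length_bypass_le_length.trans hlen, ?_, ?_⟩
  · intro z hz
    obtain ⟨i, rfl, -⟩ :=
      Walk.mem_support_iff_exists_getVert.mp (p.support_bypass_subset_support hz)
    exact ha i
  · intro i hi _
    rw [List.getD_eq_getElem?_getD, hf, ← List.getD_eq_getElem?_getD,
      ← Walk.getVert_eq_getD_support]
    exact hb _ (hi.trans f.strictMono.le_apply)

/-- If each `R y` contains `y` and has at most `n` elements, then greedily along `L` one can colour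
with `n` colours so that `y` differs from the smaller members of `R y`. -/
theorem exists_greedy_coloring [Finite V] (L : LinearOrder V) (R : V → Set V) (n : ℕ)
    (hself : ∀ y, y ∈ R y) (hR : ∀ y, (R y).ncard ≤ n) :
    ∃ f : V → ℕ, (∀ y, f y < n) ∧ ∀ x y, L.lt x y → x ∈ R y → f x ≠ f y := by
  classical
  have free_color : ∀ (y : V) (g : V → ℕ), ∃ c < n, ∀ x ∈ R y, x ≠ y → g x ≠ c := by
    intro y g
    have hcard : (g '' (R y \ {y})).ncard < n := by
      have h1 := Set.ncard_image_le (f := g) (Set.toFinite (R y \ {y}))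
      have h2 := Set.ncard_sdiff_singleton_lt_of_mem (hself y) (Set.toFinite _)
      have h3 := hR y
      omega
    obtain ⟨c, hc, hcg⟩ := Set.exists_mem_notMem_of_ncard_lt_ncard
      (s := g '' (R y \ {y})) (t := Set.Iio n) (by simpa using hcard) (Set.toFinite _)
    exact ⟨c, hc, fun x hx hxy h => hcg ⟨x, ⟨hx, hxy⟩, h⟩⟩
  choose c hcn hc using free_color
  have wf : WellFounded L.lt := Finite.wellFounded_of_trans_of_irrefl _
  let f : V → ℕ := wf.fix fun y F => c y fun x => if h : L.lt x y then F x h else 0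
  have hf : ∀ y, f y = c y fun x => if L.lt x y then f x else 0 := by
    intro y
    simp only [f]
    rw [wf.fix_eq]
    simp
  refine ⟨f, fun y => hf y ▸ hcn _ _, fun x y hxy hx => ?_⟩
  have := hc y (fun x => if L.lt x y then f x else 0) x hx (ne_of_lt hxy)
  rw [← hf] at this
  simpa only [if_pos hxy] using this

/-- The vertices reachable from `x` by a walk of length less than half of `k`, or by a negative walk of
length exactly half of `k`. -/
def negBall (G : SimpleGraph V) (σ : Sym2 V → Bool) (k : ℕ) (x : V) : Set V :=
  {v | ∃ p : G.Walk x v, 2 * p.length < k ∨ 2 * p.length = k ∧ IsNegWalk σ p}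

variable {σ : Sym2 V → Bool} {k : ℕ}

theorem self_mem_negBall (hk : 1 ≤ k) (x : V) : x ∈ negBall G σ k x :=
  ⟨Walk.nil, Or.inl (by simpa using Nat.lt_of_lt_of_le Nat.zero_lt_one hk)⟩

theorem exists_walk_of_mem_negBall {x v : V} (hv : v ∈ negBall G σ k x) :
    ∃ p : G.Walk x v, 2 * p.length ≤ k ∧ ∀ i, p.getVert i ∈ negBall G σ k x := by
  obtain ⟨p, hp⟩ := hv
  refine ⟨p, by omega, fun i => ?_⟩
  by_cases hi : i < p.length
  · refine ⟨p.take i, Or.inl ?_⟩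
    rw [Walk.take_length]
    omega
  · rw [Walk.getVert_of_length_le p (by omega)]
    exact ⟨p, hp⟩

/-- Directed form of the adjacency relation of `exactDistNeg`. -/
def IsExactNeg (G : SimpleGraph V) (σ : Sym2 V → Bool) (k : ℕ) (x y : V) : Prop :=
  G.dist x y = k ∧ ∀ p : G.Walk x y, p.IsPath → p.length = k → IsNegWalk σ p

theorem IsExactNeg.symm {x y : V} (h : IsExactNeg G σ k x y) : IsExactNeg G σ k y x := by
  refine ⟨by rw [dist_comm, h.1], fun p hp hl => ?_⟩
  have := h.2 p.reverse hp.reverse (by simpa using hl)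
  rwa [IsNegWalk, negCount_reverse] at this

theorem IsExactNeg.isNegWalk {x y : V} (h : IsExactNeg G σ k x y) (p : G.Walk x y)
    (hp : p.length = k) : IsNegWalk σ p :=
  h.2 p (p.isPath_of_length_eq_dist (hp.trans h.1.symm)) hp

theorem IsExactNeg.disjoint_negBall {x y : V} (h : IsExactNeg G σ k x y) :
    Disjoint (negBall G σ k x) (negBall G σ k y) := by
  rw [Set.disjoint_left]
  rintro v ⟨p, hp⟩ ⟨q, hq⟩
  have hle : k ≤ p.length + q.length := by
    simpa [h.1] using dist_le (p.append q.reverse)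
  obtain ⟨hpl, hpn⟩ := hp.resolve_left (by omega)
  obtain ⟨hql, hqn⟩ := hq.resolve_left (by omega)
  have hneg := h.isNegWalk (p.append q.reverse) (by simp; omega)
  rw [IsNegWalk, negCount_append, negCount_reverse] at hneg
  exact Nat.not_even_iff_odd.mpr hneg (Odd.add_odd hpn hqn)

/-- On a geodesic between the ends of an exact-distance negative pair, each vertex lies in
the ball of one of the ends; beyond the middle this is the far end. -/
theorem IsExactNeg.getVert_mem_negBall {x y : V} (h : IsExactNeg G σ k x y) (p : G.Walk x y)
    (hp : p.length = k) {i : ℕ} (hi : i ≤ k) :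
    (p.getVert i ∈ negBall G σ k x ∨ p.getVert i ∈ negBall G σ k y) ∧
      (k < 2 * i → p.getVert i ∈ negBall G σ k y) := by
  have hright : k < 2 * i → p.getVert i ∈ negBall G σ k y := fun hki =>
    ⟨(p.drop i).reverse, Or.inl (by rw [Walk.length_reverse, Walk.drop_length]; omega)⟩
  refine ⟨?_, hright⟩
  rcases lt_trichotomy (2 * i) k with hki | hki | hki
  · exact Or.inl ⟨p.take i, Or.inl (by rw [Walk.take_length]; omega)⟩
  · have hneg := h.isNegWalk p hp
    rw [← p.append_take_drop_eq i, IsNegWalk, negCount_append, Nat.odd_add'] at hneg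
    by_cases hodd : Odd (negCount σ (p.drop i))
    · exact Or.inr ⟨(p.drop i).reverse, Or.inr ⟨by
        rw [Walk.length_reverse, Walk.drop_length]; omega, by
        rwa [IsNegWalk, negCount_reverse]⟩⟩
    · refine Or.inl ⟨p.take i, Or.inr ⟨by rw [Walk.take_length]; omega, ?_⟩⟩
      rw [IsNegWalk]
      grind
  · exact Or.inr (hright hki)

theorem IsExactNeg.mem_DReach (L : LinearOrder V) (hk : 1 ≤ k) {n : ℕ}
    (hkn : k + 2 * (k / 2) ≤ n) {x y a b : V} (h : IsExactNeg G σ k x y)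
    (hax : a ∈ negBall G σ k x) (ha : ∀ v ∈ negBall G σ k x, L.le a v)
    (hby : b ∈ negBall G σ k y) (hb : ∀ v ∈ negBall G σ k y, L.le b v) (hab : L.lt a b) :
    a ∈ DReach G L n b := by
  have hab' : L.le a b := le_of_lt hab
  obtain ⟨q, hql, hq⟩ := exists_walk_of_mem_negBall hax
  obtain ⟨r, hrl, hr⟩ := exists_walk_of_mem_negBall hby
  obtain ⟨p, hp⟩ := (Reachable.of_dist_ne_zero (by rw [h.1]; omega)).exists_walk_length_eq_dist
  rw [h.1] at hp
  have hra : ∀ i, L.le a (r.getVert i) := fun i => le_trans hab' (hb _ (hr i))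
  refine mem_DReach_of_walk (q.reverse.append (p.append r)) (by simp; omega) ?_ ?_
  · intro i
    simp only [Walk.getVert_append, Walk.getVert_reverse, Walk.length_reverse]
    split_ifs with h1 h2
    · exact ha _ (hq _)
    · rcases (h.getVert_mem_negBall p hp (i := i - q.length) (by omega)).1 with hv | hv
      · exact ha _ hv
      · exact le_trans hab' (hb _ hv)
    · exact hra _
  · intro i hi
    simp only [Walk.getVert_append, Walk.length_reverse]
    rw [if_neg (by omega)]
    split_ifs with h2
    · exact hb _ ((h.getVert_mem_negBall p hp (i := i - q.length) (by omega)).2 (by omega))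
    · exact hb _ (hr _)

theorem exactDistNeg_colorable_dcol [Finite V] (hk : 1 ≤ k) {n : ℕ}
    (hkn : k + 2 * (k / 2) ≤ n) : (exactDistNeg G σ k).Colorable (dcol G n) := by
  classical
  have : Nonempty (LinearOrder V) := ⟨linearOrderOfSTO WellOrderingRel⟩
  obtain ⟨L, hL⟩ : ∃ L : LinearOrder V, ⨆ y, (DReach G L n y).ncard = dcol G n :=
    Nat.sInf_mem (Set.range_nonempty fun L : LinearOrder V => ⨆ y, (DReach G L n y).ncard)
  have hself : ∀ y, y ∈ DReach G L n y := fun y =>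
    mem_DReach_of_walk Walk.nil (by simp) (fun _ => le_refl y) (fun _ _ => le_refl y)
  obtain ⟨f, hfn, hf⟩ := exists_greedy_coloring L (DReach G L n) (dcol G n) hself
    fun y => hL ▸ le_ciSup (Set.finite_range fun y => (DReach G L n y).ncard).bddAbove y
  have hmin : ∀ x, ∃ a ∈ negBall G σ k x, ∀ v ∈ negBall G σ k x, L.le a v := fun x =>
    Set.exists_min_image _ id (Set.toFinite _) ⟨x, self_mem_negBall hk x⟩
  choose m hm hmle using hmin
  have hne : ∀ x y, IsExactNeg G σ k x y → f (m x) ≠ f (m y) := by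
    intro x y h
    have hxy : m x ≠ m y := h.disjoint_negBall.ne_of_mem (hm x) (hm y)
    rcases lt_or_gt_of_ne hxy with hlt | hlt
    · exact hf _ _ hlt (h.mem_DReach L hk hkn (hm x) (hmle x) (hm y) (hmle y) hlt)
    · exact (hf _ _ hlt (h.symm.mem_DReach L hk hkn (hm y) (hmle y) (hm x) (hmle x) hlt)).symm
  rw [colorable_iff_exists_bdd_nat_coloring]
  refine ⟨Coloring.mk (fun x => f (m x)) fun {x y} hxy => ?_, fun x => hfn _⟩
  rcases hxy.2 with h | h
  · exact hne x y h
  · exact (hne y x h).symm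

end ExactDistance

theorem exactDistNeg_chromatic_le_dcol
    {V : Type} [Fintype V] (G : SimpleGraph V) (σ : Sym2 V → Bool) (k : ℕ) (hk : 1 ≤ k) :
    (exactDistNeg G σ k).chromaticNumber ≤ (dcol G (2 * k) : ℕ∞) ∧
      (Odd k → (exactDistNeg G σ k).chromaticNumber ≤ (dcol G (2 * k - 1) : ℕ∞)) := by
  refine ⟨(exactDistNeg_colorable_dcol hk (by omega)).chromaticNumber_le, ?_⟩
  rintro ⟨j, rfl⟩
  exact (exactDistNeg_colorable_dcol hk (by omega)).chromaticNumber_le
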